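/- (Proposition 1, part 2) Decomposition of sparse scaled diagonally dominant matrices: let E be a symmetric set of off-diagonal index pairs of {1,…,n} (a graph edge set, not necessarily chordal) and let C_1,…,C_p ⊆ {1,…,n} be a clique edge cover of E. Then a real symmetric matrix Z with Z_{ij} = 0 whenever i ≠ j and (i,j) ∉ E is scaled diagonally dominant if and only if there exist real symmetric scaled diagonally dominant matrices Z_k of size |C_k|×|C_k|, k = 1,…,p, such that Z = ∑_{k=1}^p E_{C_k}ᵀ Z_k E_{C_k}. -/

import Mathlib

open Matrix BigOperators

/-- A real symmetric matrix is diagonally dominant (DD) if each diagonal entry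
dominates the sum of absolute values of the off-diagonal entries in its row. -/
def IsDiagDom {n : ℕ} (A : Matrix (Fin n) (Fin n) ℝ) : Prop :=
  ∀ i, ∑ j ∈ Finset.univ.erase i, |A i j| ≤ A i i

/-- A real symmetric matrix is scaled diagonally dominant (SDD) if `D * A * D`
is diagonally dominant for some diagonal `D` with strictly positive diagonal. -/
def IsSDD {n : ℕ} (A : Matrix (Fin n) (Fin n) ℝ) : Prop :=
  ∃ d : Fin n → ℝ, (∀ i, 0 < d i) ∧
    IsDiagDom (Matrix.diagonal d * A * Matrix.diagonal d)

/-- The 0/1 entry-selector matrix `E_C` of an index subset `C ⊆ {1,…,n}`: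
row `k` has a `1` in the column of the `k`-th smallest element of `C`. -/
def entrySelector {n : ℕ} (C : Finset (Fin n)) : Matrix (Fin C.card) (Fin n) ℝ :=
  Matrix.of fun k i => if ((C.orderIsoOfFin rfl k : Fin n) = i) then 1 else 0

/-- The comparison matrix: off-diagonal entries are replaced by minus their absolute values. -/
def comparisonMatrix {n : ℕ} (A : Matrix (Fin n) (Fin n) ℝ) : Matrix (Fin n) (Fin n) ℝ :=
  Matrix.of fun i j => if i = j then A i i else -|A i j|

lemma comparisonMatrix_apply_self {n : ℕ} (A : Matrix (Fin n) (Fin n) ℝ) (i : Fin n) :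
    comparisonMatrix A i i = A i i := by
  simp [comparisonMatrix]

lemma comparisonMatrix_apply_ne {n : ℕ} (A : Matrix (Fin n) (Fin n) ℝ) {i j : Fin n}
    (h : i ≠ j) : comparisonMatrix A i j = -|A i j| := by
  simp [comparisonMatrix, h]

lemma comparisonMatrix_offDiag_nonpos {n : ℕ} (A : Matrix (Fin n) (Fin n) ℝ) {i j : Fin n}
    (h : i ≠ j) : comparisonMatrix A i j ≤ 0 := by
  simp [comparisonMatrix_apply_ne A h]

lemma comparisonMatrix_symm {n : ℕ} {A : Matrix (Fin n) (Fin n) ℝ} (hA : A.IsSymm)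
    (i j : Fin n) : comparisonMatrix A i j = comparisonMatrix A j i := by
  by_cases h : i = j
  · rw [h]
  · rw [comparisonMatrix_apply_ne A h, comparisonMatrix_apply_ne A (Ne.symm h), hA.apply]

lemma isSDD_iff_sum_erase_le {n : ℕ} (A : Matrix (Fin n) (Fin n) ℝ) :
    IsSDD A ↔ ∃ d : Fin n → ℝ, (∀ i, 0 < d i) ∧
      ∀ i, ∑ j ∈ Finset.univ.erase i, |A i j| * d j ≤ A i i * d i := by
  refine exists_congr fun d => and_congr_right fun hd => forall_congr' fun i => ?_
  have h : ∀ j, |(diagonal d * A * diagonal d) i j| = d i * (|A i j| * d j) := by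
    intro j
    rw [mul_diagonal, diagonal_mul, abs_mul, abs_mul, abs_of_pos (hd i), abs_of_pos (hd j)]
    ring
  simp only [h]
  rw [← Finset.mul_sum, mul_diagonal, diagonal_mul, mul_assoc]
  exact mul_le_mul_iff_right₀ (hd i)

lemma isSDD_iff_comparisonMatrix {n : ℕ} (A : Matrix (Fin n) (Fin n) ℝ) :
    IsSDD A ↔ ∃ d : Fin n → ℝ, (∀ i, 0 < d i) ∧
      ∀ i, 0 ≤ ∑ j, comparisonMatrix A i j * d j := by
  rw [isSDD_iff_sum_erase_le]
  refine exists_congr fun d => and_congr_right fun hd => forall_congr' fun i => ?_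
  have h : ∑ j ∈ Finset.univ.erase i, comparisonMatrix A i j * d j
      = -∑ j ∈ Finset.univ.erase i, |A i j| * d j := by
    rw [← Finset.sum_neg_distrib]
    refine Finset.sum_congr rfl fun j hj => ?_
    rw [comparisonMatrix_apply_ne A (Finset.ne_of_mem_erase hj).symm, neg_mul]
  rw [← Finset.add_sum_erase _ _ (Finset.mem_univ i), comparisonMatrix_apply_self, h,
    ← sub_eq_add_neg, sub_nonneg]

/-- A symmetric Z-matrix mapping some positive vector to a nonnegative one has a nonnegative
quadratic form. -/
lemma sum_mul_mul_nonneg_of_scaling {n : ℕ} {M : Matrix (Fin n) (Fin n) ℝ}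
    (hsymm : ∀ i j, M i j = M j i) (hoff : ∀ i j, i ≠ j → M i j ≤ 0)
    {d : Fin n → ℝ} (hd : ∀ i, 0 < d i) (hMd : ∀ i, 0 ≤ ∑ j, M i j * d j) (x : Fin n → ℝ) :
    0 ≤ ∑ i, ∑ j, M i j * x i * x j := by
  have key : ∀ i j, (x i ^ 2 / d i * (M i j * d j) + x j ^ 2 / d j * (M j i * d i)) / 2
      ≤ M i j * x i * x j := by
    intro i j
    have hi := hd i
    have hj := hd j
    rcases eq_or_ne i j with rfl | hij
    · apply le_of_eq
      field_simp
      ring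
    · have h := mul_nonneg (mul_nonneg (neg_nonneg.2 (hoff i j hij)) (mul_pos hi hj).le)
        (sq_nonneg (x i / d i - x j / d j))
      rw [← hsymm i j]
      have e : M i j * x i * x j
          - (x i ^ 2 / d i * (M i j * d j) + x j ^ 2 / d j * (M i j * d i)) / 2
          = -M i j * (d i * d j) * (x i / d i - x j / d j) ^ 2 / 2 := by
        field_simp
        ring
      linarith
  have hrow : ∀ i, 0 ≤ ∑ j, x i ^ 2 / d i * (M i j * d j) := by
    intro i
    rw [← Finset.mul_sum]
    exact mul_nonneg (div_nonneg (sq_nonneg _) (hd i).le) (hMd i)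
  have htot := Finset.sum_nonneg fun i (_ : i ∈ Finset.univ) => hrow i
  refine le_trans ?_ (Finset.sum_le_sum fun i _ => Finset.sum_le_sum fun j _ => key i j)
  simp only [← Finset.sum_div, Finset.sum_add_distrib]
  rw [Finset.sum_comm (f := fun i j => x j ^ 2 / d j * (M j i * d i))]
  positivity

/-- A symmetric Z-matrix whose quadratic form is nonnegative on nonnegative vectors maps some
positive vector to a nonnegative one. The proof eliminates one variable at a time by Schur
complements. -/
lemma exists_scaling_of_sum_mul_mul_nonneg {n : ℕ} (M : Matrix (Fin n) (Fin n) ℝ)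
    (hsymm : ∀ i j, M i j = M j i) (hoff : ∀ i j, i ≠ j → M i j ≤ 0)
    (hq : ∀ x : Fin n → ℝ, (∀ i, 0 ≤ x i) → 0 ≤ ∑ i, ∑ j, M i j * x i * x j) :
    ∃ d : Fin n → ℝ, (∀ i, 0 < d i) ∧ ∀ i, 0 ≤ ∑ j, M i j * d j := by
  induction n with
  | zero => exact ⟨fun _ => 1, fun i => i.elim0, fun i => i.elim0⟩
  | succ n ih =>
    set a := M 0 0 with ha
    set b : Fin n → ℝ := fun j => M 0 j.succ with hb
    have hb0 : ∀ j, b j ≤ 0 := fun j => hoff _ _ (Fin.succ_ne_zero j).symm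
    have hform : ∀ (t : ℝ) (y : Fin n → ℝ), 0 ≤ t → (∀ i, 0 ≤ y i) →
        0 ≤ a * t ^ 2 + 2 * t * (∑ j, b j * y j)
          + ∑ i, ∑ j, M i.succ j.succ * y i * y j := by
      intro t y ht hy
      have h := hq (Fin.cons t y) (Fin.cases ht hy)
      simp only [Fin.sum_univ_succ, Fin.cons_zero, Fin.cons_succ, Finset.sum_add_distrib] at h
      have e1 : ∑ j : Fin n, M 0 j.succ * t * y j = t * ∑ j, b j * y j := by
        rw [Finset.mul_sum]
        exact Finset.sum_congr rfl fun j _ => by rw [hb]; ring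
      have e2 : ∑ j : Fin n, M j.succ 0 * y j * t = t * ∑ j, b j * y j := by
        rw [Finset.mul_sum]
        exact Finset.sum_congr rfl fun j _ => by rw [hsymm, hb]; ring
      rw [e1, e2] at h
      linarith
    have ha0 : 0 ≤ a := by
      simpa using hform 1 0 zero_le_one fun _ => le_rfl
    have hab : a = 0 → ∀ j, b j = 0 := by
      intro h0 j
      by_contra hne
      have hlt : b j < 0 := lt_of_le_of_ne (hb0 j) hne
      have hN := hform 0 (Pi.single j 1) le_rfl fun i => by
        by_cases h : i = j <;> simp [h]
      have h := hform ((M j.succ j.succ + 1) / (-b j)) (Pi.single j 1)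
      simp only [Pi.single_apply, h0, mul_ite, mul_one, mul_zero, zero_mul,
        Finset.sum_ite_eq', Finset.mem_univ, if_true, zero_add] at hN h
      have h2 := h (div_nonneg (by linarith) (by linarith)) fun i => by split_ifs <;> norm_num
      have e : 2 * ((M j.succ j.succ + 1) / -b j) * b j = -2 * (M j.succ j.succ + 1) := by
        field_simp
      linarith
    obtain ⟨d, hd, hSd⟩ := ih (Matrix.of fun i j => M i.succ j.succ - b i * b j / a)
      (fun i j => by simp only [Matrix.of_apply]; rw [hsymm, mul_comm (b i)])
      (fun i j hij => by
        have h1 := hoff i.succ j.succ (by simpa using hij)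
        have h2 := div_nonneg (mul_nonneg_of_nonpos_of_nonpos (hb0 i) (hb0 j)) ha0
        simp only [Matrix.of_apply]
        linarith)
      (fun y hy => by
        set β := ∑ j, b j * y j with hβ
        have hβ0 : β ≤ 0 :=
          Finset.sum_nonpos fun j _ => mul_nonpos_of_nonpos_of_nonneg (hb0 j) (hy j)
        have h := hform (-β / a) y (div_nonneg (by linarith) ha0) hy
        have e : ∑ i, ∑ j, (b i * b j / a) * y i * y j = β * β / a := by
          rw [hβ, Finset.sum_mul_sum, Finset.sum_div]
          refine Finset.sum_congr rfl fun i _ => ?_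
          rw [Finset.sum_div]
          exact Finset.sum_congr rfl fun j _ => by ring
        have e2 : a * (-β / a) ^ 2 + 2 * (-β / a) * β = -(β * β / a) := by
          rcases eq_or_ne a 0 with h0 | h0
          · simp [h0]
          · field_simp
            ring
        simp only [Matrix.of_apply, sub_mul, Finset.sum_sub_distrib]
        rw [e]
        linarith)
    set β := ∑ j, b j * d j with hβ
    have hβ0 : β ≤ 0 :=
      Finset.sum_nonpos fun j _ => mul_nonpos_of_nonpos_of_nonneg (hb0 j) (hd j).le
    have hS : ∀ i, 0 ≤ ∑ j, M i.succ j.succ * d j - b i * β / a := by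
      intro i
      have h := hSd i
      simp only [Matrix.of_apply, sub_mul, Finset.sum_sub_distrib] at h
      have e : ∑ j, b i * b j / a * d j = b i * β / a := by
        rw [hβ, Finset.mul_sum, Finset.sum_div]
        exact Finset.sum_congr rfl fun j _ => by ring
      rwa [e] at h
    rcases eq_or_lt_of_le hβ0 with h0 | hneg
    · have hbz : ∀ j, b j = 0 := by
        intro j
        have h := (Finset.sum_eq_zero_iff_of_nonpos fun j _ =>
          mul_nonpos_of_nonpos_of_nonneg (hb0 j) (hd j).le).1 h0 j (Finset.mem_univ j)
        exact (mul_eq_zero.1 h).resolve_right (hd j).ne'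
      refine ⟨Fin.cons 1 d, Fin.cases one_pos hd, Fin.cases ?_ fun i => ?_⟩
      · simp only [Fin.sum_univ_succ, Fin.cons_zero, Fin.cons_succ]
        change 0 ≤ a * 1 + β
        linarith
      · have h := hS i
        simp only [Fin.sum_univ_succ, Fin.cons_zero, Fin.cons_succ]
        rw [hsymm i.succ 0]
        change 0 ≤ b i * 1 + _
        rw [hbz] at h ⊢
        simpa using h
    · have hapos : 0 < a := by
        refine lt_of_le_of_ne ha0 fun h => hneg.ne ?_
        simp [hβ, hab h.symm]
      refine ⟨Fin.cons (-β / a) d, Fin.cases (div_pos (by linarith) hapos) hd,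
        Fin.cases ?_ fun i => ?_⟩
      · simp only [Fin.sum_univ_succ, Fin.cons_zero, Fin.cons_succ]
        change 0 ≤ a * (-β / a) + β
        rw [mul_div_cancel₀ _ hapos.ne']
        linarith
      · have h := hS i
        simp only [Fin.sum_univ_succ, Fin.cons_zero, Fin.cons_succ]
        rw [hsymm i.succ 0]
        change 0 ≤ b i * (-β / a) + _
        have e : b i * (-β / a) = -(b i * β / a) := by ring
        linarith

/-- A symmetric matrix is scaled diagonally dominant iff the quadratic form of its comparison
matrix is nonnegative on nonnegative vectors. -/
lemma isSDD_iff_comparisonMatrix_form_nonneg {n : ℕ} {A : Matrix (Fin n) (Fin n) ℝ}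
    (hA : A.IsSymm) :
    IsSDD A ↔ ∀ x : Fin n → ℝ, (∀ i, 0 ≤ x i) →
      0 ≤ ∑ i, ∑ j, comparisonMatrix A i j * x i * x j := by
  rw [isSDD_iff_comparisonMatrix]
  refine ⟨fun ⟨d, hd, h⟩ x _ => ?_, fun h => ?_⟩
  · exact sum_mul_mul_nonneg_of_scaling (comparisonMatrix_symm hA)
      (fun i j => comparisonMatrix_offDiag_nonpos A) hd h x
  · exact exists_scaling_of_sum_mul_mul_nonneg _ (comparisonMatrix_symm hA)
      (fun i j => comparisonMatrix_offDiag_nonpos A) h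

lemma entrySelector_apply {n : ℕ} (C : Finset (Fin n)) (a : Fin C.card) (i : Fin n) :
    entrySelector C a i = if C.orderEmbOfFin rfl a = i then 1 else 0 :=
  rfl

lemma entrySelector_conj_apply {n : ℕ} (C : Finset (Fin n))
    (A : Matrix (Fin C.card) (Fin C.card) ℝ) (i j : Fin n) :
    ((entrySelector C)ᵀ * A * entrySelector C) i j =
      ∑ a, ∑ b, if C.orderEmbOfFin rfl a = i ∧ C.orderEmbOfFin rfl b = j then A a b else 0 := by
  simp only [Matrix.mul_apply, Finset.sum_mul, Matrix.transpose_apply,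
    entrySelector_apply]
  rw [Finset.sum_comm]
  refine Finset.sum_congr rfl fun a _ => Finset.sum_congr rfl fun b _ => ?_
  split_ifs <;> simp_all

lemma entrySelector_conj_apply_orderEmbOfFin {n : ℕ} (C : Finset (Fin n))
    (A : Matrix (Fin C.card) (Fin C.card) ℝ) (a b : Fin C.card) :
    ((entrySelector C)ᵀ * A * entrySelector C) (C.orderEmbOfFin rfl a) (C.orderEmbOfFin rfl b)
      = A a b := by
  simp [entrySelector_conj_apply, ite_and]

lemma entrySelector_conj_apply_of_notMem {n : ℕ} (C : Finset (Fin n))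
    (A : Matrix (Fin C.card) (Fin C.card) ℝ) {i j : Fin n} (h : ¬ (i ∈ C ∧ j ∈ C)) :
    ((entrySelector C)ᵀ * A * entrySelector C) i j = 0 := by
  rw [entrySelector_conj_apply]
  refine Finset.sum_eq_zero fun a _ => Finset.sum_eq_zero fun b _ => if_neg ?_
  rintro ⟨rfl, rfl⟩
  exact h ⟨C.orderEmbOfFin_mem rfl a, C.orderEmbOfFin_mem rfl b⟩

lemma exists_orderEmbOfFin_eq {n : ℕ} {C : Finset (Fin n)} {i : Fin n} (hi : i ∈ C) :
    ∃ a, C.orderEmbOfFin rfl a = i := by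
  rwa [← Set.mem_range, Finset.range_orderEmbOfFin, Finset.mem_coe]

/-- Restricting a matrix supported on `C × C` to `C` and embedding it back recovers it. -/
lemma entrySelector_conj_submatrix {n : ℕ} (C : Finset (Fin n)) (W : Matrix (Fin n) (Fin n) ℝ)
    (hW : ∀ i j, ¬ (i ∈ C ∧ j ∈ C) → W i j = 0) :
    (entrySelector C)ᵀ * W.submatrix (C.orderEmbOfFin rfl) (C.orderEmbOfFin rfl)
      * entrySelector C = W := by
  ext i j
  by_cases h : i ∈ C ∧ j ∈ C
  · obtain ⟨a, rfl⟩ := exists_orderEmbOfFin_eq h.1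
    obtain ⟨b, rfl⟩ := exists_orderEmbOfFin_eq h.2
    rw [entrySelector_conj_apply_orderEmbOfFin, submatrix_apply]
  · rw [entrySelector_conj_apply_of_notMem C _ h, hW i j h]

lemma comparisonMatrix_entrySelector_conj {n : ℕ} (C : Finset (Fin n))
    (A : Matrix (Fin C.card) (Fin C.card) ℝ) :
    comparisonMatrix ((entrySelector C)ᵀ * A * entrySelector C)
      = (entrySelector C)ᵀ * comparisonMatrix A * entrySelector C := by
  ext i j
  by_cases h : i ∈ C ∧ j ∈ C
  · obtain ⟨a, rfl⟩ := exists_orderEmbOfFin_eq h.1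
    obtain ⟨b, rfl⟩ := exists_orderEmbOfFin_eq h.2
    simp [comparisonMatrix, entrySelector_conj_apply_orderEmbOfFin]
  · simp [comparisonMatrix, entrySelector_conj_apply_of_notMem C _ h]
    rintro rfl
    rw [entrySelector_conj_apply_of_notMem C _ h]

lemma sum_entrySelector_conj_mul_mul {n : ℕ} (C : Finset (Fin n))
    (A : Matrix (Fin C.card) (Fin C.card) ℝ) (x : Fin n → ℝ) :
    ∑ i, ∑ j, ((entrySelector C)ᵀ * A * entrySelector C) i j * x i * x j
      = ∑ a, ∑ b, A a b * x (C.orderEmbOfFin rfl a) * x (C.orderEmbOfFin rfl b) := by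
  have hform : ∀ {m : ℕ} (B : Matrix (Fin m) (Fin m) ℝ) (y : Fin m → ℝ),
      ∑ i, ∑ j, B i j * y i * y j = y ⬝ᵥ (B *ᵥ y) := by
    intro m B y
    simp only [dotProduct, mulVec, Finset.mul_sum]
    exact Finset.sum_congr rfl fun i _ => Finset.sum_congr rfl fun j _ => by ring
  have hE : entrySelector C *ᵥ x = fun a => x (C.orderEmbOfFin rfl a) := by
    ext a
    simp [mulVec, dotProduct, entrySelector_apply]
  rw [hform, hform A fun a => x (C.orderEmbOfFin rfl a), ← mulVec_mulVec, ← mulVec_mulVec, hE,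
    dotProduct_mulVec, vecMul_transpose, hE]

/-- A clique-sum of symmetric scaled diagonally dominant matrices is scaled diagonally
dominant. -/
lemma isSDD_sum_entrySelector_conj {n p : ℕ} (C : Fin p → Finset (Fin n))
    (A : (k : Fin p) → Matrix (Fin (C k).card) (Fin (C k).card) ℝ)
    (hA : ∀ k, (A k).IsSymm ∧ IsSDD (A k)) {Z : Matrix (Fin n) (Fin n) ℝ} (hZ : Z.IsSymm)
    (hsum : Z = ∑ k, (entrySelector (C k))ᵀ * A k * entrySelector (C k)) : IsSDD Z := by
  rw [isSDD_iff_comparisonMatrix_form_nonneg hZ]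
  intro x hx
  have hle : ∀ i j, ∑ k, ((entrySelector (C k))ᵀ * comparisonMatrix (A k)
      * entrySelector (C k)) i j ≤ comparisonMatrix Z i j := by
    intro i j
    simp only [← comparisonMatrix_entrySelector_conj]
    rcases eq_or_ne i j with rfl | hij
    · simp only [comparisonMatrix_apply_self]
      rw [hsum, Matrix.sum_apply]
    · simp only [comparisonMatrix_apply_ne _ hij, Finset.sum_neg_distrib]
      rw [hsum, Matrix.sum_apply, neg_le_neg_iff]
      exact Finset.abs_sum_le_sum_abs _ _
  calc 0 ≤ ∑ k, ∑ i, ∑ j, ((entrySelector (C k))ᵀ * comparisonMatrix (A k)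
        * entrySelector (C k)) i j * x i * x j := by
        refine Finset.sum_nonneg fun k _ => ?_
        rw [sum_entrySelector_conj_mul_mul]
        exact (isSDD_iff_comparisonMatrix_form_nonneg (hA k).1).1 (hA k).2 _ fun a => hx _
    _ = ∑ i, ∑ j, (∑ k, ((entrySelector (C k))ᵀ * comparisonMatrix (A k)
        * entrySelector (C k)) i j) * x i * x j := by
        simp only [Finset.sum_mul]
        rw [Finset.sum_comm]
        exact Finset.sum_congr rfl fun i _ => Finset.sum_comm
    _ ≤ _ := Finset.sum_le_sum fun i _ => Finset.sum_le_sum fun j _ =>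
        mul_le_mul_of_nonneg_right (mul_le_mul_of_nonneg_right (hle i j) (hx i)) (hx j)

/-- A matrix supported on `C × C` that satisfies the scaled dominance inequalities on `C`
restricts to a scaled diagonally dominant matrix. -/
lemma isSDD_submatrix_orderEmbOfFin {n : ℕ} (C : Finset (Fin n)) (W : Matrix (Fin n) (Fin n) ℝ)
    {d : Fin n → ℝ} (hd : ∀ i, 0 < d i)
    (hW : ∀ i ∈ C, ∑ j ∈ Finset.univ.erase i, |W i j| * d j ≤ W i i * d i) :
    IsSDD (W.submatrix (C.orderEmbOfFin rfl) (C.orderEmbOfFin rfl)) := by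
  rw [isSDD_iff_sum_erase_le]
  refine ⟨fun a => d (C.orderEmbOfFin rfl a), fun a => hd _, fun a => ?_⟩
  refine le_trans ?_ (hW _ (C.orderEmbOfFin_mem rfl a))
  simp only [submatrix_apply]
  refine (Finset.sum_map (Finset.univ.erase a) (C.orderEmbOfFin rfl).toEmbedding
    fun j => |W (C.orderEmbOfFin rfl a) j| * d j).symm.trans_le ?_
  refine Finset.sum_le_sum_of_subset_of_nonneg ?_
    fun j _ _ => mul_nonneg (abs_nonneg _) (hd j).le
  intro j hj
  obtain ⟨b, hb, rfl⟩ := Finset.mem_map.1 hj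
  simpa using hb

/-- A symmetric scaled diagonally dominant matrix whose support is covered by the squares
`C k × C k` splits into symmetric scaled diagonally dominant matrices on the sets `C k`. -/
lemma exists_isSDD_decomposition {n p : ℕ} (C : Fin p → Finset (Fin n))
    (hcover : ∀ i, ∃ k, i ∈ C k) {Z : Matrix (Fin n) (Fin n) ℝ} (hZ : Z.IsSymm)
    (hsupp : ∀ i j, i ≠ j → Z i j ≠ 0 → ∃ k, i ∈ C k ∧ j ∈ C k) (hSDD : IsSDD Z) :
    ∃ A : (k : Fin p) → Matrix (Fin (C k).card) (Fin (C k).card) ℝ,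
      (∀ k, (A k).IsSymm ∧ IsSDD (A k)) ∧
      Z = ∑ k, (entrySelector (C k))ᵀ * A k * entrySelector (C k) := by
  obtain ⟨d, hd, hdom⟩ := (isSDD_iff_sum_erase_le Z).1 hSDD
  let I : Fin p → Fin n → Fin n → ℝ := fun k i j => if i ∈ C k ∧ j ∈ C k then 1 else 0
  let w : Fin n → Fin n → ℝ := fun i j => ∑ k, I k i j
  have hI : ∀ k i j, 0 ≤ I k i j := fun k i j => by
    dsimp only [I]
    split_ifs <;> norm_num
  have hIsymm : ∀ k i j, I k i j = I k j i := fun k i j => by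
    simp only [I, and_comm]
  have hwsymm : ∀ i j, w i j = w j i := fun i j => by
    simp only [w, hIsymm _ i j]
  have hw : ∀ i j, 0 ≤ w i j := fun i j => Finset.sum_nonneg fun k _ => hI k i j
  have hwpos : ∀ {i j}, (∃ k, i ∈ C k ∧ j ∈ C k) → 0 < w i j := by
    rintro i j ⟨k, hk⟩
    refine Finset.sum_pos' (fun k _ => hI k i j) ⟨k, Finset.mem_univ k, ?_⟩
    simp [I, hk]
  let V : Fin p → Fin n → Fin n → ℝ := fun k i j => I k i j * (Z i j / w i j)
  let slack : Fin n → ℝ := fun i => Z i i * d i - ∑ j ∈ Finset.univ.erase i, |Z i j| * d j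
  have hVsum : ∀ i j, (i ≠ j) → ∑ k, V k i j = Z i j := by
    intro i j hij
    rw [← Finset.sum_mul]
    by_cases h : Z i j = 0
    · simp [h]
    · exact mul_div_cancel₀ _ (hwpos (hsupp i j hij h)).ne'
  have hVabs : ∀ i j, (i ≠ j) → ∑ k, |V k i j| = |Z i j| := by
    intro i j hij
    have e : ∀ k, |V k i j| = I k i j * (|Z i j| / w i j) := fun k => by
      simp only [V]
      rw [abs_mul, abs_div, abs_of_nonneg (hI k i j), abs_of_nonneg (hw i j)]
    simp only [e]
    rw [← Finset.sum_mul]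
    by_cases h : Z i j = 0
    · simp [h]
    · exact mul_div_cancel₀ _ (hwpos (hsupp i j hij h)).ne'
  let W : Fin p → Matrix (Fin n) (Fin n) ℝ := fun k => Matrix.of fun i j =>
    if i = j then
      (∑ l ∈ Finset.univ.erase i, |V k i l| * d l + I k i i * (slack i / w i i)) / d i
    else V k i j
  have hWsymm : ∀ k, (W k).IsSymm := by
    intro k
    refine Matrix.IsSymm.ext fun i j => ?_
    rcases eq_or_ne i j with rfl | hij
    · rfl
    · simp only [W, Matrix.of_apply, if_neg hij, if_neg hij.symm, V]
      rw [hIsymm k j i, hwsymm j i, hZ.apply]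
  have hWsupp : ∀ k i j, ¬ (i ∈ C k ∧ j ∈ C k) → W k i j = 0 := by
    intro k i j h
    have hV : ∀ l, ¬ (i ∈ C k ∧ l ∈ C k) → V k i l = 0 := fun l hl => by
      simp only [V, I, if_neg hl, zero_mul]
    rcases eq_or_ne i j with rfl | hij
    · have hi : i ∉ C k := fun hi => h ⟨hi, hi⟩
      have hV' : ∀ l, V k i l = 0 := fun l => hV l fun hl => hi hl.1
      simp [W, hV', I, hi]
    · simp only [W, Matrix.of_apply, if_neg hij]
      exact hV j h
  have hWdom : ∀ k i, ∑ j ∈ Finset.univ.erase i, |W k i j| * d j ≤ W k i i * d i := by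
    intro k i
    have hoff : ∑ j ∈ Finset.univ.erase i, |W k i j| * d j
        = ∑ j ∈ Finset.univ.erase i, |V k i j| * d j := by
      refine Finset.sum_congr rfl fun j hj => ?_
      simp only [W, Matrix.of_apply, if_neg (Finset.ne_of_mem_erase hj).symm]
    have hdiag : W k i i * d i
        = ∑ l ∈ Finset.univ.erase i, |V k i l| * d l + I k i i * (slack i / w i i) := by
      simp only [W, Matrix.of_apply, if_true]
      exact div_mul_cancel₀ _ (hd i).ne'
    rw [hoff, hdiag]
    exact le_add_of_nonneg_right
      (mul_nonneg (hI k i i) (div_nonneg (sub_nonneg.2 (hdom i)) (hw i i)))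
  refine ⟨fun k => (W k).submatrix ((C k).orderEmbOfFin rfl) ((C k).orderEmbOfFin rfl),
    fun k => ⟨(hWsymm k).submatrix _, isSDD_submatrix_orderEmbOfFin _ _ hd fun i _ => hWdom k i⟩,
    ?_⟩
  simp only [fun k => entrySelector_conj_submatrix (C k) (W k) (hWsupp k)]
  ext i j
  rw [Matrix.sum_apply]
  rcases eq_or_ne i j with rfl | hij
  · obtain ⟨k, hk⟩ := hcover i
    simp only [W, Matrix.of_apply, if_true]
    rw [← Finset.sum_div, eq_div_iff (hd i).ne', Finset.sum_add_distrib, ← Finset.sum_mul,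
      mul_div_cancel₀ _ (hwpos ⟨k, hk, hk⟩).ne', Finset.sum_comm,
      Finset.sum_congr rfl (g := fun l => |Z i l| * d l)]
    · simp only [slack]
      ring
    · intro l hl
      rw [← Finset.sum_mul, hVabs i l (Finset.ne_of_mem_erase hl).symm]
  · simp only [W, Matrix.of_apply, if_neg hij]
    exact (hVsum i j hij).symm

/-- (Proposition 1, part 2.) Let `E` be a (not necessarily chordal) graph edge
set on `{1,…,n}` with clique edge cover `C_1,…,C_p`. A symmetric matrix `Z`
with sparsity pattern `E` is scaled diagonally dominant iff it is a clique-sum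
`Z = ∑ₖ E_{C_k}ᵀ Z_k E_{C_k}` of symmetric scaled diagonally dominant `Z_k`. -/
theorem sparse_sdd_decomposition {n p : ℕ}
    (E : Fin n → Fin n → Prop)
    (hEsymm : ∀ i j, E i j → E j i) (hEirrefl : ∀ i, ¬ E i i)
    (C : Fin p → Finset (Fin n))
    (hclique : ∀ k, ∀ i ∈ C k, ∀ j ∈ C k, i ≠ j → E i j)
    (hcoverE : ∀ i j, E i j → ∃ k, i ∈ C k ∧ j ∈ C k)
    (hcoverV : ∀ i : Fin n, ∃ k, i ∈ C k)
    (Z : Matrix (Fin n) (Fin n) ℝ) (hZsymm : Z.IsSymm)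
    (hZsparse : ∀ i j, i ≠ j → ¬ E i j → Z i j = 0) :
    IsSDD Z ↔
      ∃ Zk : (k : Fin p) → Matrix (Fin (C k).card) (Fin (C k).card) ℝ,
        (∀ k, (Zk k).IsSymm ∧ IsSDD (Zk k)) ∧
        Z = ∑ k, (entrySelector (C k))ᵀ * Zk k * entrySelector (C k) := by
  constructor
  · refine exists_isSDD_decomposition C hcoverV hZsymm fun i j hij hne => hcoverE i j ?_
    by_contra hE
    exact hne (hZsparse i j hij hE)
  · rintro ⟨A, hA, hsum⟩
    exact isSDD_sum_entrySelector_conj C A hA hZsymm hsum
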